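/- arXiv:1901.10014 — 6 statements merged into one kernel-verified Lean document; each statement's English description precedes it below -/
import Mathlib

section
/- Let G be a group, H ≤ H' ≤ G subgroups, X a set with a right H'-action (restricted to H where needed), and φ: G → H' a group homomorphism satisfying φ(h) = h for all h ∈ H. Then the map θ: X ∗_H G → X × (H\G) sending the class of (x, g) to (x·φ(g), Hg) is well defined and is a G-equivariant bijection, where G acts on X ∗_H G by (x∗g')·g = x∗(g'g) and on X × (H\G) by (x, Hg)·g' = (x·φ(g'), Hgg'). -/
/-- Let `G` be a group, `H ≤ H' ≤ G` subgroups, `X` a set with a right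
`H'`-action `act` (restricted to `H` via the inclusion where needed), and `φ : G → H'` a
group homomorphism with `φ(h) = h` for all `h ∈ H`.  Then the map
`θ : X ∗_H G → X × (H\G)`, `[(x, g)] ↦ (x·φ(g), Hg)`, is well defined and is a
`G`-equivariant bijection.  Here `X ∗_H G` is the quotient of `X × G` by the relation
`(x, g) ∼ (x·h, h⁻¹g)` for `h ∈ H`; well-definedness together with injectivity of the
induced map on the quotient is expressed by the equivalence `θ̃ p = θ̃ q ↔ p ∼ q` for the
map `θ̃` on representatives; `G` acts on `X ∗_H G` by `(x∗g')·g = x∗(g'g)` and on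
`X × (H\G)` by `(x, Hg)·g' = (x·φ(g'), Hgg')`. -/
theorem stmt1 {G : Type*} [Group G] (H H' : Subgroup G) (hle : H ≤ H')
    {X : Type*} (act : X → H' → X)
    (act_one : ∀ x, act x 1 = x)
    (act_mul : ∀ x h₁ h₂, act (act x h₁) h₂ = act x (h₁ * h₂))
    (φ : G →* H') (hφ : ∀ h : H, φ (h : G) = Subgroup.inclusion hle h) :
    let rel : X × G → X × G → Prop := fun p q =>
      ∃ h : H, q.1 = act p.1 (Subgroup.inclusion hle h) ∧ q.2 = (h : G)⁻¹ * p.2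
    let θ : X × G → X × Quotient (QuotientGroup.rightRel H) := fun p =>
      (act p.1 (φ p.2), Quotient.mk (QuotientGroup.rightRel H) p.2)
    (∀ p q : X × G, θ p = θ q ↔ rel p q) ∧
    Function.Surjective θ ∧
    (∀ (x : X) (g₀ g : G),
      θ (x, g₀ * g) =
        (act (θ (x, g₀)).1 (φ g), Quotient.mk (QuotientGroup.rightRel H) (g₀ * g))) := by
  intro rel θ
  refine ⟨?_, ?_, ?_⟩
  · rintro ⟨x, a⟩ ⟨y, b⟩
    constructor
    · intro h
      have h1 : act x (φ a) = act y (φ b) := congrArg Prod.fst h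
      have h2 : b * a⁻¹ ∈ H :=
        QuotientGroup.rightRel_apply.1 (Quotient.exact (congrArg Prod.snd h))
      refine ⟨⟨b * a⁻¹, h2⟩⁻¹, ?_, ?_⟩
      · show y = act x _
        rw [← hφ]
        have e : φ (((⟨b * a⁻¹, h2⟩⁻¹ : H) : G)) = φ a * (φ b)⁻¹ := by
          simp
        rw [e, ← act_mul, h1, act_mul, mul_inv_cancel, act_one]
      · show b = _
        simp
    · rintro ⟨h, h1, h2⟩
      have h1' : y = act x (Subgroup.inclusion hle h) := h1
      have h2' : b = (h : G)⁻¹ * a := h2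
      refine Prod.ext ?_ ?_
      · show act x (φ a) = act y (φ b)
        rw [h1', h2', act_mul, ← hφ, ← map_mul, mul_inv_cancel_left]
      · refine Quotient.sound (QuotientGroup.rightRel_apply.2 ?_)
        show b * a⁻¹ ∈ H
        rw [h2', mul_inv_cancel_right]
        exact H.inv_mem h.2
  · rintro ⟨x, c⟩
    induction c using Quotient.inductionOn with
    | h g =>
      refine ⟨(act x (φ g)⁻¹, g), ?_⟩
      refine Prod.ext ?_ rfl
      show act (act x (φ g)⁻¹) (φ g) = x
      rw [act_mul, inv_mul_cancel, act_one]
  · intro x g₀ g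
    refine Prod.ext ?_ rfl
    show act x (φ (g₀ * g)) = act (act x (φ g₀)) (φ g)
    rw [act_mul, map_mul]
end

section
/- Let Q be a quiver, A ⊆ Q₁ a set of arrows such that the underlying undirected graph on Q₀ with edge set A has no cycles (i.e., is a forest; A is admissible for contraction), and d: Q₀ → ℕ a dimension vector with d(ta) = d(ha) for every a ∈ A. Let U ⊆ rep_Q(d) be the set of representations V such that V_a is invertible for every a ∈ A, let R ⊆ rep_Q(d) be the set of V with V_a equal to the identity matrix for every a ∈ A, and let H = {g ∈ GL(d) : g_{ta} = g_{ha} for all a ∈ A}. Then the action map R × GL(d) → U, (W, g) ↦ W·g, is well defined and surjective, and for (W, g), (W', g') ∈ R × GL(d) one has W·g = W'·g' if and only if there exists h ∈ H with W' = W·h and g' = h⁻¹g. In particular it induces a GL(d)-equivariant bijection R ∗_H GL(d) → U. -/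
open Matrix

namespace Stmt4Aux

/-- Rectangular identity matrix. -/
def J (k : Type*) [Field k] (n m : ℕ) : Matrix (Fin n) (Fin m) k :=
  fun i j => if (i : ℕ) = (j : ℕ) then (1 : k) else 0

theorem J_self (k : Type*) [Field k] (n : ℕ) : J k n n = 1 := by
  ext i j
  simp [J, Matrix.one_apply, Fin.ext_iff]

theorem J_mul_J {k : Type*} [Field k] {n m : ℕ} (e : n = m) : J k n m * J k m n = 1 := by
  subst e
  simp [J_self]

theorem J_comm {k : Type*} [Field k] {n m : ℕ} (e : n = m)
    (x : Matrix (Fin n) (Fin n) k) (y : Matrix (Fin m) (Fin m) k)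
    (hxy : x * J k n m = J k n m * y) (i j : Fin n) :
    x i j = y (Fin.cast e i) (Fin.cast e j) := by
  subst e
  rw [J_self, Matrix.mul_one, Matrix.one_mul] at hxy
  subst hxy
  rfl

theorem cancel1 {k : Type*} [Field k] {n m : ℕ} (x : (Matrix (Fin n) (Fin n) k)ˣ)
    (B : Matrix (Fin n) (Fin m) k) :
    (x : Matrix (Fin n) (Fin n) k) * (x⁻¹.1 * B) = B := by
  rw [← Matrix.mul_assoc, Units.mul_inv, Matrix.one_mul]

theorem cancel2 {k : Type*} [Field k] {n m : ℕ} (x : (Matrix (Fin n) (Fin n) k)ˣ)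
    (B : Matrix (Fin n) (Fin m) k) :
    ((x⁻¹ : (Matrix (Fin n) (Fin n) k)ˣ) : Matrix (Fin n) (Fin n) k) *
      ((x : Matrix (Fin n) (Fin n) k) * B) = B := by
  rw [← Matrix.mul_assoc, Units.inv_mul, Matrix.one_mul]

theorem cancel3 {k : Type*} [Field k] {n m l : ℕ} {M : Matrix (Fin n) (Fin m) k}
    {N : Matrix (Fin m) (Fin n) k} (hMN : M * N = 1)
    (B : Matrix (Fin n) (Fin l) k) : M * (N * B) = B := by
  rw [← Matrix.mul_assoc, hMN, Matrix.one_mul]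

/-- Transport along a walk. -/
def trans {V : Type*} {G : SimpleGraph V} {X : V → Type*}
    (f : ∀ u v, G.Adj u v → X u → X v) (x0 : ∀ r, X r) :
    ∀ {u r : V}, G.Walk u r → X u
  | _, r, SimpleGraph.Walk.nil => x0 r
  | _, _, SimpleGraph.Walk.cons e p => f _ _ e.symm (trans f x0 p)

theorem forest_step {V : Type*} {G : SimpleGraph V} (hG : G.IsAcyclic) {u v r : V}
    (e : G.Adj u v) (p : G.Walk u r) (hp : p.IsPath) (q : G.Walk v r) (hq : q.IsPath) :
    p = SimpleGraph.Walk.cons e q ∨ q = SimpleGraph.Walk.cons e.symm p := by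
  classical
  by_cases hv : v ∈ p.support
  · by_cases hu : u ∈ q.support
    · exfalso
      have h1 : p.dropUntil v hv = q :=
        congrArg Subtype.val ((hG.subsingleton_path _ _).elim ⟨_, hp.dropUntil hv⟩ ⟨q, hq⟩)
      have h2 : q.dropUntil u hu = p :=
        congrArg Subtype.val ((hG.subsingleton_path _ _).elim ⟨_, hq.dropUntil hu⟩ ⟨p, hp⟩)
      have h3 := congrArg SimpleGraph.Walk.length (p.take_spec hv)
      have h4 := congrArg SimpleGraph.Walk.length (q.take_spec hu)
      rw [SimpleGraph.Walk.length_append, h1] at h3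
      rw [SimpleGraph.Walk.length_append, h2] at h4
      have h5 : (p.takeUntil v hv).length = 0 := by omega
      exact e.ne (SimpleGraph.Walk.eq_of_length_eq_zero h5)
    · left
      exact congrArg Subtype.val ((hG.subsingleton_path _ _).elim ⟨p, hp⟩ ⟨_, hq.cons hu⟩)
  · right
    exact congrArg Subtype.val ((hG.subsingleton_path _ _).elim ⟨q, hq⟩ ⟨_, hp.cons hv⟩)

theorem forest_section {V : Type*} {G : SimpleGraph V} (hG : G.IsAcyclic) {X : V → Type*}
    (x0 : ∀ r, X r) (P : ∀ u v, X u → X v → Prop)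
    (hsymm : ∀ u v x y, P u v x y → P v u y x)
    (htot : ∀ u v, G.Adj u v → ∀ x, ∃ y, P u v x y) :
    ∃ g : ∀ u, X u, ∀ u v, G.Adj u v → P u v (g u) (g v) := by
  choose f hf using htot
  have hroot : ∀ u, G.Reachable u (G.connectedComponentMk u).out := fun u => by
    have := Quot.out_eq (G.connectedComponentMk u)
    exact (SimpleGraph.ConnectedComponent.exact this).symm
  have hpath : ∀ u, ∃ p : G.Walk u (G.connectedComponentMk u).out, p.IsPath :=
    fun u => (hroot u).exists_isPath
  choose p hp using hpath
  refine ⟨fun u => trans f x0 (p u), fun u v e => ?_⟩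
  have key : ∀ r r' : V, r = r' → ∀ (a : G.Walk u r) (b : G.Walk v r'), a.IsPath → b.IsPath →
      P u v (trans f x0 a) (trans f x0 b) := by
    intro r r' hr a b ha hb
    subst hr
    rcases forest_step hG e a ha b hb with h | h
    · rw [h]
      exact hsymm _ _ _ _ (hf _ _ e.symm _)
    · rw [h]
      exact hf _ _ e _
  refine key _ _ ?_ _ _ (hp u) (hp v)
  rw [SimpleGraph.ConnectedComponent.connectedComponentMk_eq_of_adj e]

/-- The symmetrized edge relation. -/
inductive Rel {Q0 Q1 : Type*} (t h : Q1 → Q0) (A : Set Q1) {X : Q0 → Type*}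
    (C : ∀ a, X (t a) → X (h a) → Prop) : ∀ u v, X u → X v → Prop
  | fwd (a : Q1) (ha : a ∈ A) (x : X (t a)) (y : X (h a)) (hc : C a x y) :
      Rel t h A C (t a) (h a) x y
  | bwd (a : Q1) (ha : a ∈ A) (x : X (t a)) (y : X (h a)) (hc : C a x y) :
      Rel t h A C (h a) (t a) y x

theorem Rel.inv {Q0 Q1 : Type*} {t h : Q1 → Q0} {A : Set Q1} {X : Q0 → Type*}
    {C : ∀ a, X (t a) → X (h a) → Prop} {u v : Q0} {x : X u} {y : X v}
    (hr : Rel t h A C u v x y) (g : ∀ u, X u) (hx : g u = x) (hy : g v = y) :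
    ∃ b ∈ A, s(t b, h b) = s(u, v) ∧ C b (g (t b)) (g (h b)) := by
  cases hr with
  | fwd a ha _ _ hc => exact ⟨a, ha, rfl, by rw [hx, hy]; exact hc⟩
  | bwd a ha _ _ hc => exact ⟨a, ha, Sym2.eq_swap, by rw [hx, hy]; exact hc⟩

theorem quiver_section {Q0 Q1 : Type*} (t h : Q1 → Q0) (A : Set Q1) {X : Q0 → Type*}
    (x0 : ∀ r, X r) (C : ∀ a, X (t a) → X (h a) → Prop)
    (hloop : ∀ a ∈ A, t a ≠ h a)
    (hnopar : ∀ a ∈ A, ∀ b ∈ A, a ≠ b → s(t a, h a) ≠ s(t b, h b))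
    (hacyc : (SimpleGraph.fromRel (fun z z' : Q0 => ∃ a ∈ A, t a = z ∧ h a = z')).IsAcyclic)
    (h1 : ∀ a ∈ A, ∀ x, ∃ y, C a x y) (h2 : ∀ a ∈ A, ∀ y, ∃ x, C a x y) :
    ∃ g : ∀ u, X u, ∀ a ∈ A, C a (g (t a)) (g (h a)) := by
  obtain ⟨g, hg⟩ := forest_section hacyc x0 (Rel t h A C)
    (by
      intro u v x y hr
      cases hr with
      | fwd a ha _ _ hc => exact Rel.bwd a ha _ _ hc
      | bwd a ha _ _ hc => exact Rel.fwd a ha _ _ hc)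
    (by
      intro u v e x
      rw [SimpleGraph.fromRel_adj] at e
      obtain ⟨_, ⟨a, ha, rfl, rfl⟩ | ⟨a, ha, rfl, rfl⟩⟩ := e
      · obtain ⟨y, hy⟩ := h1 a ha x
        exact ⟨y, Rel.fwd a ha _ _ hy⟩
      · obtain ⟨y, hy⟩ := h2 a ha x
        exact ⟨y, Rel.bwd a ha _ _ hy⟩)
  refine ⟨g, fun a ha => ?_⟩
  have hr := hg (t a) (h a) (by
    rw [SimpleGraph.fromRel_adj]
    exact ⟨hloop a ha, Or.inl ⟨a, ha, rfl, rfl⟩⟩)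
  obtain ⟨b, hb, hs, hc⟩ := hr.inv g rfl rfl
  have hab : b = a := by
    by_contra hne
    exact hnopar b hb a ha hne hs
  subst hab
  exact hc

end Stmt4Aux

open Stmt4Aux

/-- Let `Q` be a quiver (tail/head maps `t, h : Q1 → Q0`), `A ⊆ Q1` a set
of arrows whose underlying undirected graph is a forest (no loops, no parallel edges, and
the associated simple graph is acyclic), and `d` a dimension vector with `d(ta) = d(ha)`
for `a ∈ A`.  Let `U` be the representations `V` with `V_a` invertible for all `a ∈ A`,
`R` those with `V_a` the identity matrix for all `a ∈ A`, and
`H = {g ∈ GL(d) : g_{ta} = g_{ha} ∀ a ∈ A}`.  Then the action map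
`R × GL(d) → U`, `(W, g) ↦ W·g`, is well defined and surjective, and
`W·g = W'·g' ↔ ∃ h ∈ H, W' = W·h ∧ g' = h⁻¹g`; in particular it induces a
`GL(d)`-equivariant bijection `R ∗_H GL(d) → U`. -/
theorem stmt4 {k : Type*} [Field k] {Q0 Q1 : Type*} (t h : Q1 → Q0) (A : Set Q1)
    (d : Q0 → ℕ)
    (hd : ∀ a ∈ A, d (t a) = d (h a))
    (hloop : ∀ a ∈ A, t a ≠ h a)
    (hnopar : ∀ a ∈ A, ∀ b ∈ A, a ≠ b → s(t a, h a) ≠ s(t b, h b))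
    (hacyc : (SimpleGraph.fromRel (fun z z' : Q0 => ∃ a ∈ A, t a = z ∧ h a = z')).IsAcyclic) :
    let act : (∀ a : Q1, Matrix (Fin (d (t a))) (Fin (d (h a))) k) →
        (∀ z : Q0, (Matrix (Fin (d z)) (Fin (d z)) k)ˣ) →
        (∀ a : Q1, Matrix (Fin (d (t a))) (Fin (d (h a))) k) := fun V g a =>
      (((g (t a))⁻¹ : (Matrix (Fin (d (t a))) (Fin (d (t a))) k)ˣ) :
          Matrix (Fin (d (t a))) (Fin (d (t a))) k) * V a *
        ((g (h a) : (Matrix (Fin (d (h a))) (Fin (d (h a))) k)ˣ) :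
          Matrix (Fin (d (h a))) (Fin (d (h a))) k)
    let U : Set (∀ a : Q1, Matrix (Fin (d (t a))) (Fin (d (h a))) k) :=
      {V | ∀ a ∈ A, ∃ M : Matrix (Fin (d (h a))) (Fin (d (t a))) k,
        V a * M = 1 ∧ M * V a = 1}
    let R : Set (∀ a : Q1, Matrix (Fin (d (t a))) (Fin (d (h a))) k) :=
      {V | ∀ a ∈ A, ∀ (i : Fin (d (t a))) (j : Fin (d (h a))),
        V a i j = if (i : ℕ) = (j : ℕ) then (1 : k) else 0}
    let H : Set (∀ z : Q0, (Matrix (Fin (d z)) (Fin (d z)) k)ˣ) :=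
      {g | ∀ a : Q1, ∀ ha : a ∈ A, ∀ (i j : Fin (d (t a))),
        ((g (t a) : (Matrix (Fin (d (t a))) (Fin (d (t a))) k)ˣ) :
            Matrix (Fin (d (t a))) (Fin (d (t a))) k) i j =
          ((g (h a) : (Matrix (Fin (d (h a))) (Fin (d (h a))) k)ˣ) :
              Matrix (Fin (d (h a))) (Fin (d (h a))) k)
            (Fin.cast (hd a ha) i) (Fin.cast (hd a ha) j)}
    (∀ W ∈ R, ∀ g, act W g ∈ U) ∧
    (∀ V ∈ U, ∃ W ∈ R, ∃ g, V = act W g) ∧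
    (∀ W ∈ R, ∀ W' ∈ R, ∀ g g',
      act W g = act W' g' ↔ ∃ hh ∈ H, W' = act W hh ∧ g' = hh⁻¹ * g) := by
  intro act U R H
  have hR : ∀ W ∈ R, ∀ a ∈ A, W a = J k (d (t a)) (d (h a)) := by
    intro W hW a ha
    ext i j
    exact hW a ha i j
  refine ⟨?_, ?_, ?_⟩
  · intro W hW g a ha
    have e := hd a ha
    refine ⟨((g (h a))⁻¹).1 *
      (J k (d (h a)) (d (t a)) * (g (t a)).1), ?_, ?_⟩
    · simp only [act, hR W hW a ha, Matrix.mul_assoc, cancel1, cancel3 (J_mul_J e)]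
      exact Units.inv_mul _
    · simp only [act, hR W hW a ha, Matrix.mul_assoc, cancel1, cancel3 (J_mul_J e.symm)]
      exact Units.inv_mul _
  · intro V hV
    obtain ⟨g, hg⟩ := quiver_section t h A (X := fun z => (Matrix (Fin (d z)) (Fin (d z)) k)ˣ)
      (fun _ => 1) (fun a x y => J k (d (t a)) (d (h a)) * y.1 = x.1 * V a) hloop hnopar hacyc
      (by
        intro a ha x
        obtain ⟨M, hM1, hM2⟩ := hV a ha
        have e := hd a ha
        refine ⟨⟨J k (d (h a)) (d (t a)) * (x.1 * V a),
          M * (x⁻¹.1 * J k (d (t a)) (d (h a))), ?_, ?_⟩, ?_⟩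
        · simp only [Matrix.mul_assoc, cancel1, cancel3 hM1, J_mul_J e.symm]
        · simp only [Matrix.mul_assoc, cancel2, cancel3 (J_mul_J e), hM2]
        · exact cancel3 (J_mul_J e) _)
      (by
        intro a ha y
        obtain ⟨M, hM1, hM2⟩ := hV a ha
        have e := hd a ha
        refine ⟨⟨J k (d (t a)) (d (h a)) * (y.1 * M),
          V a * (y⁻¹.1 * J k (d (h a)) (d (t a))), ?_, ?_⟩, ?_⟩
        · simp only [Matrix.mul_assoc, cancel1, cancel3 hM2, J_mul_J e]
        · simp only [Matrix.mul_assoc, cancel2, cancel3 (J_mul_J e.symm), hM1]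
        · simp only [Matrix.mul_assoc, hM2, Matrix.mul_one])
    refine ⟨act V g⁻¹, ?_, g, ?_⟩
    · intro a ha i j
      have : act V g⁻¹ a = J k (d (t a)) (d (h a)) := by
        simp only [act, Pi.inv_apply, inv_inv]
        rw [← hg a ha, Matrix.mul_assoc, Units.mul_inv, Matrix.mul_one]
      rw [this]
      rfl
    · funext a
      simp only [act, Pi.inv_apply, inv_inv, Matrix.mul_assoc, cancel2, Units.inv_mul,
        Matrix.mul_one]
  · intro W hW W' hW' g g'
    constructor
    · intro hE
      have hW'' : W' = act W (g * g'⁻¹) := by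
        funext a
        have := congrFun hE a
        simp only [act, Matrix.mul_assoc] at this
        simp only [act, Pi.mul_apply, Pi.inv_apply, _root_.mul_inv_rev, inv_inv, Units.val_mul]
        have h3 := congrArg (fun B => (g' (t a)).1 * B * ((g' (h a))⁻¹).1) this
        simp only [Matrix.mul_assoc, cancel1, Units.mul_inv, Matrix.mul_one] at h3
        simp only [Matrix.mul_assoc]
        exact h3.symm
      refine ⟨g * g'⁻¹, ?_, hW'', by simp⟩
      intro a ha i j
      refine J_comm (hd a ha) _ _ ?_ i j
      have h4 := congrFun hW'' a
      simp only [act, hR W hW a ha, hR W' hW' a ha, Matrix.mul_assoc] at h4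
      have h5 := congrArg (fun B => ((g * g'⁻¹) (t a)).1 * B) h4
      simp only [cancel1] at h5
      exact h5
    · rintro ⟨hh, -, rfl, rfl⟩
      funext a
      simp only [act, Pi.mul_apply, Pi.inv_apply, _root_.mul_inv_rev, inv_inv, Units.val_mul,
        Matrix.mul_assoc, cancel1]
end

section
/- The map u ↦ v₀u is a bijection from the group w⁻¹U'w ∩ U₋ onto the set S̃. -/
open Matrix

/-- `i` lies in the block of length `len` starting at offset `off`. -/
abbrev inBlk (off len i : ℕ) : Prop := off ≤ i ∧ i < off + len

/-- `(i, j)` is a position of a `1` of an antidiagonal-ones block `J` of size `len`,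
with row offset `roff` and column offset `coff`. -/
abbrev Jpos (roff coff len i j : ℕ) : Prop :=
  inBlk roff len i ∧ inBlk coff len j ∧ (i - roff) + (j - coff) = len - 1

/-- `(i, j)` is a position of a `1` of an identity block of size `len`,
with row offset `roff` and column offset `coff`. -/
abbrev Ipos (roff coff len i j : ℕ) : Prop :=
  inBlk roff len i ∧ inBlk coff len j ∧ i - roff = j - coff

/-- The matrix `v₀`: block rows of sizes `(q, r, s, t, r, s)`, block columns of sizes
`(s, s, r, q, t, r)`; nonzero blocks `(1,4)=J`, `(2,3)=J`, `(3,1)=J`, `(4,5)=1`,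
`(5,3)=J`, `(5,6)=1`, `(6,1)=J`, `(6,2)=1`. -/
def vzero (k : Type*) [Field k] (q r s t : ℕ) :
    Matrix (Fin (q + r + s + (t + r + s))) (Fin (q + r + s + (t + r + s))) k :=
  Matrix.of fun i j =>
    if Jpos 0 (2 * s + r) q (i : ℕ) (j : ℕ) ∨
       Jpos q (2 * s) r (i : ℕ) (j : ℕ) ∨
       Jpos (q + r) 0 s (i : ℕ) (j : ℕ) ∨
       Ipos (q + r + s) (2 * s + r + q) t (i : ℕ) (j : ℕ) ∨
       Jpos (q + r + s + t) (2 * s) r (i : ℕ) (j : ℕ) ∨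
       Ipos (q + r + s + t) (2 * s + r + q + t) r (i : ℕ) (j : ℕ) ∨
       Jpos (q + r + s + t + r) 0 s (i : ℕ) (j : ℕ) ∨
       Ipos (q + r + s + t + r) s s (i : ℕ) (j : ℕ)
    then 1 else 0

/-- The set `S̃`: matrices of the same shape as `v₀`, except that the blocks in positions
`(1,2), (2,2), (4,2), (5,2)` (all in the second column block, of sizes `q×s, r×s, t×s,
r×s`) are arbitrary. -/
def sTilde (k : Type*) [Field k] (q r s t : ℕ) :
    Set (Matrix (Fin (q + r + s + (t + r + s))) (Fin (q + r + s + (t + r + s))) k) :=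
  {g | ∀ i j : Fin (q + r + s + (t + r + s)),
    ¬ (inBlk s s (j : ℕ) ∧
        (inBlk 0 q (i : ℕ) ∨ inBlk q r (i : ℕ) ∨ inBlk (q + r + s) t (i : ℕ) ∨
          inBlk (q + r + s + t) r (i : ℕ))) →
    g i j = vzero k q r s t i j}

/-- The permutation matrix `w`: block rows `(s, r, q, t, r, s)`, block columns
`(s, s, r, q, t, r)`; nonzero blocks `(1,2)=J`, `(2,6)=J`, `(3,4)=J`, `(4,5)=1`,
`(5,3)=J`, `(6,1)=J`. -/
def wMat (k : Type*) [Field k] (q r s t : ℕ) :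
    Matrix (Fin (q + r + s + (t + r + s))) (Fin (q + r + s + (t + r + s))) k :=
  Matrix.of fun i j =>
    if Jpos 0 s s (i : ℕ) (j : ℕ) ∨
       Jpos s (2 * s + r + q + t) r (i : ℕ) (j : ℕ) ∨
       Jpos (s + r) (2 * s + r) q (i : ℕ) (j : ℕ) ∨
       Ipos (s + r + q) (2 * s + r + q) t (i : ℕ) (j : ℕ) ∨
       Jpos (s + r + q + t) (2 * s) r (i : ℕ) (j : ℕ) ∨
       Jpos (s + r + q + t + r) 0 s (i : ℕ) (j : ℕ)
    then 1 else 0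

/-- The unipotent radical `U'` of `B'` (block rows and columns `(s, r, q, t, r, s)`):
lower triangular, all diagonal entries `1`, and the middle `(q+t)×(q+t)` diagonal square
(spanning the two identity diagonal blocks and the `(4,3)` block) equal to the identity. -/
def uPrime (k : Type*) [Field k] (q r s t : ℕ) :
    Set (Matrix (Fin (q + r + s + (t + r + s))) (Fin (q + r + s + (t + r + s))) k) :=
  {g | (∀ i j : Fin (q + r + s + (t + r + s)), (i : ℕ) < (j : ℕ) → g i j = 0) ∧
    (∀ i : Fin (q + r + s + (t + r + s)), g i i = 1) ∧
    (∀ i j : Fin (q + r + s + (t + r + s)),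
      inBlk (s + r) (q + t) (i : ℕ) → inBlk (s + r) (q + t) (j : ℕ) → (i : ℕ) ≠ (j : ℕ) →
      g i j = 0)}

/-- The lower triangular unipotent group `U₋`. -/
def uMinus (k : Type*) [Field k] (q r s t : ℕ) :
    Set (Matrix (Fin (q + r + s + (t + r + s))) (Fin (q + r + s + (t + r + s))) k) :=
  {g | (∀ i j : Fin (q + r + s + (t + r + s)), (i : ℕ) < (j : ℕ) → g i j = 0) ∧
    (∀ i : Fin (q + r + s + (t + r + s)), g i i = 1)}


namespace Stmt6Aux

/-- the permutation of `w` (column to row) -/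
def sg (q r s t j : ℕ) : ℕ :=
  if j < s then s + r + q + t + r + (s - 1 - j)
  else if j < 2 * s then 2 * s - 1 - j
  else if j < 2 * s + r then s + r + q + t + (2 * s + r - 1 - j)
  else if j < 2 * s + r + q then s + r + (2 * s + r + q - 1 - j)
  else if j < 2 * s + r + q + t then j - s
  else s + (2 * s + r + q + t + r - 1 - j)

/-- its inverse -/
def ta (q r s t i : ℕ) : ℕ :=
  if i < s then 2 * s - 1 - i
  else if i < s + r then 2 * s + r + q + t + (s + r - 1 - i)
  else if i < s + r + q then 2 * s + r + (s + r + q - 1 - i)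
  else if i < s + r + q + t then i + s
  else if i < s + r + q + t + r then 2 * s + (s + r + q + t + r - 1 - i)
  else s + r + q + t + r + s - 1 - i

/-- main position in row `i` of `v₀` -/
def al (q r s t i : ℕ) : ℕ :=
  if i < q then 2 * s + r + (q - 1 - i)
  else if i < q + r then 2 * s + (q + r - 1 - i)
  else if i < q + r + s then q + r + s - 1 - i
  else if i < q + r + s + t then 2 * s + r + q + (i - (q + r + s))
  else if i < q + r + s + t + r then 2 * s + r + q + t + (i - (q + r + s + t))
  else s + (i - (q + r + s + t + r))

/-- inverse of `al` -/
def ali (q r s t m : ℕ) : ℕ :=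
  if m < s then q + r + (s - 1 - m)
  else if m < 2 * s then q + r + s + t + r + (m - s)
  else if m < 2 * s + r then q + (2 * s + r - 1 - m)
  else if m < 2 * s + r + q then 2 * s + r + q - 1 - m
  else if m < 2 * s + r + q + t then q + r + s + (m - (2 * s + r + q))
  else q + r + s + t + (m - (2 * s + r + q + t))

/-- second position in row `i` of `v₀`, for the last two row blocks -/
def be (q r s t i : ℕ) : ℕ :=
  if i < q + r + s + t + r then 2 * s + (q + r + s + t + r - 1 - i)
  else q + r + s + t + r + s - 1 - i

section
variable {q r s t : ℕ}

theorem sg_lt {j : ℕ} (h : j < q + r + s + (t + r + s)) :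
    sg q r s t j < q + r + s + (t + r + s) := by
  unfold sg; split_ifs <;> omega

theorem ta_lt {j : ℕ} (h : j < q + r + s + (t + r + s)) :
    ta q r s t j < q + r + s + (t + r + s) := by
  unfold ta; split_ifs <;> omega

theorem al_lt {j : ℕ} (h : j < q + r + s + (t + r + s)) :
    al q r s t j < q + r + s + (t + r + s) := by
  unfold al; split_ifs <;> omega

theorem ali_lt {j : ℕ} (h : j < q + r + s + (t + r + s)) :
    ali q r s t j < q + r + s + (t + r + s) := by
  unfold ali; split_ifs <;> omega

theorem be_lt {j : ℕ} (h : j < q + r + s + (t + r + s)) (h' : q + r + s + t ≤ j) :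
    be q r s t j < q + r + s + (t + r + s) := by
  unfold be; split_ifs <;> omega

theorem ta_sg {j : ℕ} (h : j < q + r + s + (t + r + s)) :
    ta q r s t (sg q r s t j) = j := by
  unfold sg; split_ifs <;> unfold ta <;> split_ifs <;> omega

theorem sg_ta {j : ℕ} (h : j < q + r + s + (t + r + s)) :
    sg q r s t (ta q r s t j) = j := by
  unfold ta; split_ifs <;> unfold sg <;> split_ifs <;> omega

theorem al_ali {j : ℕ} (h : j < q + r + s + (t + r + s)) :
    al q r s t (ali q r s t j) = j := by
  unfold ali; split_ifs <;> unfold al <;> split_ifs <;> omega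

theorem ali_al {j : ℕ} (h : j < q + r + s + (t + r + s)) :
    ali q r s t (al q r s t j) = j := by
  unfold al; split_ifs <;> unfold ali <;> split_ifs <;> omega

variable (k : Type*) [Field k]

theorem wMat_apply (i j : Fin (q + r + s + (t + r + s))) :
    wMat k q r s t i j = if i = (⟨sg q r s t j, sg_lt j.2⟩ : Fin _) then 1 else 0 := by
  obtain ⟨i, hi⟩ := i
  obtain ⟨j, hj⟩ := j
  simp only [wMat, Matrix.of_apply, Fin.mk.injEq]
  congr 1
  simp only [Jpos, Ipos, inBlk, eq_iff_iff]
  unfold sg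
  constructor
  · rintro (h | h | h | h | h | h) <;> split_ifs <;> omega
  · intro h
    split_ifs at h
    · iterate 5 right
      omega
    · left
      omega
    · iterate 4 right
      left
      omega
    · iterate 2 right
      left
      omega
    · iterate 3 right
      left
      omega
    · right
      left
      omega

theorem vzero_apply (i j : Fin (q + r + s + (t + r + s))) :
    vzero k q r s t i j = (if j = (⟨al q r s t i, al_lt i.2⟩ : Fin _) then 1 else 0) +
      (if h : q + r + s + t ≤ (i : ℕ) then
        (if j = (⟨be q r s t i, be_lt i.2 h⟩ : Fin _) then 1 else 0) else 0) := by
  obtain ⟨i, hi⟩ := i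
  obtain ⟨j, hj⟩ := j
  simp only [vzero, Matrix.of_apply, Fin.mk.injEq]
  have key : (Jpos 0 (2 * s + r) q i j ∨
       Jpos q (2 * s) r i j ∨
       Jpos (q + r) 0 s i j ∨
       Ipos (q + r + s) (2 * s + r + q) t i j ∨
       Jpos (q + r + s + t) (2 * s) r i j ∨
       Ipos (q + r + s + t) (2 * s + r + q + t) r i j ∨
       Jpos (q + r + s + t + r) 0 s i j ∨
       Ipos (q + r + s + t + r) s s i j) ↔
      (j = al q r s t i ∨ (q + r + s + t ≤ i ∧ j = be q r s t i)) := by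
    simp only [Jpos, Ipos, inBlk]
    unfold al be
    constructor
    · rintro (h | h | h | h | h | h | h | h) <;> split_ifs <;> omega
    · rintro (h | ⟨h0, h⟩)
      · split_ifs at h
        · left
          omega
        · right
          left
          omega
        · iterate 2 right
          left
          omega
        · iterate 3 right
          left
          omega
        · iterate 5 right
          left
          omega
        · iterate 7 right
          omega
      · split_ifs at h
        · iterate 4 right
          left
          omega
        · iterate 6 right
          left
          omega
  have ne : q + r + s + t ≤ i → al q r s t i ≠ be q r s t i := by
    intro h
    unfold al be
    split_ifs <;> omega
  simp only [key]
  by_cases h1 : j = al q r s t i <;> by_cases h2 : q + r + s + t ≤ i <;>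
    by_cases h3 : j = be q r s t i <;> simp_all

theorem vzero_mul (X : Matrix (Fin (q + r + s + (t + r + s))) (Fin (q + r + s + (t + r + s))) k)
    (i j : Fin (q + r + s + (t + r + s))) :
    (vzero k q r s t * X) i j = X ⟨al q r s t i, al_lt i.2⟩ j +
      (if h : q + r + s + t ≤ (i : ℕ) then X ⟨be q r s t i, be_lt i.2 h⟩ j else 0) := by
  simp only [Matrix.mul_apply, vzero_apply, add_mul, Finset.sum_add_distrib]
  congr 1
  · simp
  · split_ifs <;> simp

theorem wMat_inv : (wMat k q r s t)⁻¹ = (wMat k q r s t)ᵀ := by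
  apply Matrix.inv_eq_left_inv
  ext i j
  simp only [Matrix.mul_apply, Matrix.transpose_apply, wMat_apply, Matrix.one_apply]
  simp only [ite_mul, one_mul, zero_mul, Finset.sum_ite_eq', Finset.mem_univ,
    if_true]
  congr 1
  simp only [Fin.mk.injEq, eq_iff_iff]
  constructor
  · intro h
    have := congrArg (ta q r s t) h
    rw [ta_sg i.2, ta_sg j.2] at this
    exact Fin.ext this
  · rintro rfl; rfl

theorem conj_apply (X : Matrix (Fin (q + r + s + (t + r + s))) (Fin (q + r + s + (t + r + s))) k)
    (i j : Fin (q + r + s + (t + r + s))) :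
    ((wMat k q r s t)⁻¹ * X * wMat k q r s t) i j =
      X ⟨sg q r s t i, sg_lt i.2⟩ ⟨sg q r s t j, sg_lt j.2⟩ := by
  rw [wMat_inv]
  simp [Matrix.mul_apply, wMat_apply]

theorem mem_iff (u : Matrix (Fin (q + r + s + (t + r + s))) (Fin (q + r + s + (t + r + s))) k) :
    u ∈ (((fun u => (wMat k q r s t)⁻¹ * u * wMat k q r s t) '' uPrime k q r s t) ∩
        uMinus k q r s t) ↔
    ∀ i j : Fin (q + r + s + (t + r + s)), ¬ (2 * s ≤ (i : ℕ) ∧ s ≤ (j : ℕ) ∧ (j : ℕ) < 2 * s) →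
      u i j = (1 : Matrix _ _ k) i j := by
  constructor
  · rintro ⟨⟨g, ⟨h1, h2, h3⟩, rfl⟩, ⟨h4, h5⟩⟩ i j hij
    by_cases e : i = j
    · subst e
      rw [Matrix.one_apply_eq]
      exact h5 i
    rw [Matrix.one_apply_ne e]
    by_cases hlt : (i : ℕ) < j
    · exact h4 i j hlt
    have hne : (i : ℕ) ≠ j := fun h => e (Fin.ext h)
    show ((wMat k q r s t)⁻¹ * g * wMat k q r s t) i j = 0
    rw [conj_apply]
    by_cases hs : sg q r s t i < sg q r s t j
    · exact h1 _ _ hs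
    have hi := i.2
    have hj := j.2
    have hc : (inBlk (s + r) (q + t) (sg q r s t i) ∧ inBlk (s + r) (q + t) (sg q r s t j)) ∧
        sg q r s t i ≠ sg q r s t j := by
      generalize (i : ℕ) = i at *
      generalize (j : ℕ) = j at *
      clear h1 h2 h3 h4 h5
      revert hs
      simp only [inBlk]
      unfold sg
      split_ifs <;> omega
    exact h3 _ _ hc.1.1 hc.1.2 hc.2
  · intro h
    refine ⟨⟨Matrix.of fun i j => u ⟨ta q r s t i, ta_lt i.2⟩ ⟨ta q r s t j, ta_lt j.2⟩, ⟨?_, ?_, ?_⟩, ?_⟩,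
      ?_, ?_⟩
    · intro i j hij
      have hi := i.2
      have hj := j.2
      rw [Matrix.of_apply, h, Matrix.one_apply_ne]
      · intro e
        have e := congrArg (fun x : Fin _ => sg q r s t x) e
        simp only [sg_ta hi, sg_ta hj] at e
        omega
      · simp only
        generalize (i : ℕ) = i at *
        generalize (j : ℕ) = j at *
        unfold ta
        split_ifs <;> omega
    · intro i
      show u _ _ = 1
      rw [h, Matrix.one_apply_eq]
      simp only
      omega
    · intro i j hi' hj' hij
      have hi := i.2
      have hj := j.2
      rw [Matrix.of_apply, h, Matrix.one_apply_ne]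
      · intro e
        have e := congrArg (fun x : Fin _ => sg q r s t x) e
        simp only [sg_ta hi, sg_ta hj] at e
        omega
      · simp only
        simp only [inBlk] at hi' hj'
        generalize (i : ℕ) = i at *
        generalize (j : ℕ) = j at *
        unfold ta
        split_ifs <;> omega
    · ext i j
      simp only [conj_apply, Matrix.of_apply, ta_sg i.2, ta_sg j.2]
    · intro i j hij
      rw [h i j (by omega), Matrix.one_apply_ne]
      intro e
      rw [e] at hij
      omega
    · intro i
      rw [h i i (by omega), Matrix.one_apply_eq]

end

end Stmt6Aux

open Stmt6Aux in
/-- The map `u ↦ v₀u` is a bijection from `w⁻¹U'w ∩ U₋` onto `S̃`. -/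
theorem stmt6 (k : Type*) [Field k] (q r s t : ℕ)
    (hq : 1 ≤ q) (hr : 1 ≤ r) (hs : 1 ≤ s) (ht : 1 ≤ t) :
    Set.BijOn (fun u => vzero k q r s t * u)
      (((fun u => (wMat k q r s t)⁻¹ * u * wMat k q r s t) '' uPrime k q r s t) ∩
        uMinus k q r s t)
      (sTilde k q r s t) := by
  refine ⟨?_, ?_, ?_⟩
  · intro u hu
    rw [mem_iff] at hu
    intro i j hij
    show (vzero k q r s t * u) i j = _
    have e : vzero k q r s t i j = (vzero k q r s t *
          (1 : Matrix (Fin (q + r + s + (t + r + s))) (Fin (q + r + s + (t + r + s))) k)) i j := by rw [Matrix.mul_one]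
    have hi := i.2
    rw [e, vzero_mul, vzero_mul]
    simp only [inBlk] at hij
    congr 1
    · apply hu
      simp only
      generalize (i : ℕ) = i at *
      unfold al
      split_ifs <;> omega
    · split_ifs with h
      · apply hu
        simp only
        generalize (i : ℕ) = i at *
        unfold be
        split_ifs <;> omega
      · rfl
  · intro u hu u' hu' huu
    rw [mem_iff] at hu hu'
    have key : ∀ i j, (vzero k q r s t * u) i j = (vzero k q r s t * u') i j :=
      fun i j => congrFun (congrFun huu i) j
    have low : ∀ m j : Fin (q + r + s + (t + r + s)), (m : ℕ) < 2 * s + r + q + t →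
        u m j = u' m j := by
      intro m j hm
      by_cases h2 : (m : ℕ) < 2 * s
      · rw [hu m j (by omega), hu' m j (by omega)]
      have := key ⟨ali q r s t m, ali_lt m.2⟩ j
      rw [vzero_mul, vzero_mul] at this
      simp only [al_ali m.2] at this
      have hn : ¬ (q + r + s + t ≤ ali q r s t m) := by
        unfold ali
        split_ifs <;> omega
      simpa [hn] using this
    ext m j
    by_cases hm : (m : ℕ) < 2 * s + r + q + t
    · exact low m j hm
    have hm2 := m.2
    have := key ⟨ali q r s t m, ali_lt m.2⟩ j
    rw [vzero_mul, vzero_mul] at this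
    simp only [al_ali m.2] at this
    have hn : q + r + s + t ≤ ali q r s t m := by
      unfold ali
      split_ifs <;> omega
    rw [dif_pos hn, dif_pos hn, low ⟨be q r s t (ali q r s t m), _⟩ j] at this
    · exact add_right_cancel this
    · simp only
      unfold ali
      split_ifs <;> unfold be <;> split_ifs <;> omega
  · intro g hg
    let X : Matrix (Fin (q + r + s + (t + r + s))) (Fin (q + r + s + (t + r + s))) k :=
      fun m j => if 2 * s ≤ (m : ℕ) ∧ s ≤ (j : ℕ) ∧ (j : ℕ) < 2 * s then
        g ⟨ali q r s t m, ali_lt m.2⟩ j -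
          (if h : q + r + s + t ≤ ali q r s t m then
            g ⟨ali q r s t (be q r s t (ali q r s t m)), ali_lt (be_lt (ali_lt m.2) h)⟩ j else 0)
        else (1 : Matrix _ _ k) m j
    refine ⟨X, ?_, ?_⟩
    · rw [mem_iff]
      intro i j hij
      exact if_neg hij
    · ext i j
      show (vzero k q r s t * X) i j = _
      have hi := i.2
      by_cases hij : (s ≤ (j : ℕ) ∧ (j : ℕ) < 2 * s) ∧ 2 * s ≤ al q r s t i
      · rw [vzero_mul]
        simp only [X, ali_al i.2, Fin.eta]
        rw [if_pos ⟨hij.2, hij.1⟩]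
        by_cases h : q + r + s + t ≤ (i : ℕ)
        · have hb : 2 * s ≤ be q r s t i := by
            have := hij.2
            revert this
            unfold al be
            split_ifs <;> omega
          have hb2 : ¬ (q + r + s + t ≤ ali q r s t (be q r s t i)) := by
            have := hij.2
            revert this
            generalize (i : ℕ) = i at *
            unfold al be
            split_ifs <;> unfold ali <;> split_ifs <;> omega
          rw [dif_pos h, dif_pos h, if_pos ⟨hb, hij.1⟩, dif_neg hb2]
          ring
        · rw [dif_neg h, dif_neg h]
          ring
      · have e : vzero k q r s t i j = (vzero k q r s t *
          (1 : Matrix (Fin (q + r + s + (t + r + s))) (Fin (q + r + s + (t + r + s))) k)) i j := by rw [Matrix.mul_one]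
        rw [hg i j, e, vzero_mul, vzero_mul]
        · congr 1
          · apply if_neg
            simp only
            tauto
          · split_ifs with h
            · apply if_neg
              simp only
              revert hij
              generalize (i : ℕ) = i at *
              unfold al be
              split_ifs <;> omega
            · rfl
        · revert hij
          simp only [inBlk]
          generalize (i : ℕ) = i at *
          unfold al
          split_ifs <;> omega
end

section
/- Every matrix in S̃ is invertible, and if g, g' ∈ S̃ satisfy g' = κg for some κ ∈ K, then g = g' (and κ is the identity); equivalently, the map S̃ → K\GL(a+b,k), g ↦ Kg, is injective. -/
open Matrix

/-- The subgroup `K = diag(GL(a), GL(b)) ≤ GL(a+b)`, `a = q+r+s`, `b = t+r+s`, as a set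
of matrices: invertible block diagonal matrices. -/
def kDiag (k : Type*) [Field k] (q r s t : ℕ) :
    Set (Matrix (Fin (q + r + s + (t + r + s))) (Fin (q + r + s + (t + r + s))) k) :=
  {g | IsUnit g ∧ ∀ i j : Fin (q + r + s + (t + r + s)),
    (((i : ℕ) < q + r + s ∧ q + r + s ≤ (j : ℕ)) ∨
      (q + r + s ≤ (i : ℕ) ∧ (j : ℕ) < q + r + s)) → g i j = 0}

lemma vz_eq_zero {k : Type*} [Field k] {q r s t : ℕ}
    {i j : Fin (q + r + s + (t + r + s))}
    (h : ¬ (Jpos 0 (2 * s + r) q (i : ℕ) (j : ℕ) ∨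
       Jpos q (2 * s) r (i : ℕ) (j : ℕ) ∨
       Jpos (q + r) 0 s (i : ℕ) (j : ℕ) ∨
       Ipos (q + r + s) (2 * s + r + q) t (i : ℕ) (j : ℕ) ∨
       Jpos (q + r + s + t) (2 * s) r (i : ℕ) (j : ℕ) ∨
       Ipos (q + r + s + t) (2 * s + r + q + t) r (i : ℕ) (j : ℕ) ∨
       Jpos (q + r + s + t + r) 0 s (i : ℕ) (j : ℕ) ∨
       Ipos (q + r + s + t + r) s s (i : ℕ) (j : ℕ))) : vzero k q r s t i j = 0 := by
  simp only [vzero, Matrix.of_apply]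
  exact if_neg h

lemma vz_eq_one {k : Type*} [Field k] {q r s t : ℕ}
    {i j : Fin (q + r + s + (t + r + s))}
    (h : Jpos 0 (2 * s + r) q (i : ℕ) (j : ℕ) ∨
       Jpos q (2 * s) r (i : ℕ) (j : ℕ) ∨
       Jpos (q + r) 0 s (i : ℕ) (j : ℕ) ∨
       Ipos (q + r + s) (2 * s + r + q) t (i : ℕ) (j : ℕ) ∨
       Jpos (q + r + s + t) (2 * s) r (i : ℕ) (j : ℕ) ∨
       Ipos (q + r + s + t) (2 * s + r + q + t) r (i : ℕ) (j : ℕ) ∨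
       Jpos (q + r + s + t + r) 0 s (i : ℕ) (j : ℕ) ∨
       Ipos (q + r + s + t + r) s s (i : ℕ) (j : ℕ)) : vzero k q r s t i j = 1 := by
  simp only [vzero, Matrix.of_apply]
  exact if_pos h

set_option maxHeartbeats 1600000 in
/-- Every row index `m` has a column, outside block column 2, which restricted to the half of
`m` is the standard basis vector at `m`. -/
lemma exists_col (k : Type*) [Field k] (q r s t : ℕ) (m : Fin (q + r + s + (t + r + s))) :
    ∃ j : Fin (q + r + s + (t + r + s)), ¬ inBlk s s (j : ℕ) ∧
      vzero k q r s t m j = 1 ∧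
      ∀ l : Fin (q + r + s + (t + r + s)),
        ((l : ℕ) < q + r + s ↔ (m : ℕ) < q + r + s) → l ≠ m → vzero k q r s t l j = 0 := by
  obtain ⟨m, hm⟩ := m
  have key : ∀ j : ℕ, ∀ hj : j < q + r + s + (t + r + s), ¬ inBlk s s j →
      (Jpos 0 (2 * s + r) q m j ∨ Jpos q (2 * s) r m j ∨ Jpos (q + r) 0 s m j ∨
       Ipos (q + r + s) (2 * s + r + q) t m j ∨
       Jpos (q + r + s + t) (2 * s) r m j ∨
       Jpos (q + r + s + t + r) 0 s m j) →
      ∃ j : Fin (q + r + s + (t + r + s)), ¬ inBlk s s (j : ℕ) ∧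
      vzero k q r s t ⟨m, hm⟩ j = 1 ∧
      ∀ l : Fin (q + r + s + (t + r + s)),
        ((l : ℕ) < q + r + s ↔ m < q + r + s) → l ≠ ⟨m, hm⟩ →
          vzero k q r s t l j = 0 := by
    intro j hj hb h
    refine ⟨⟨j, hj⟩, hb, vz_eq_one ?_, ?_⟩
    · rcases h with h | h | h | h | h | h
      · exact Or.inl h
      · exact Or.inr (Or.inl h)
      · exact Or.inr (Or.inr (Or.inl h))
      · exact Or.inr (Or.inr (Or.inr (Or.inl h)))
      · exact Or.inr (Or.inr (Or.inr (Or.inr (Or.inl h))))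
      · exact Or.inr (Or.inr (Or.inr (Or.inr (Or.inr (Or.inr (Or.inl h))))))
    rintro ⟨l, hl⟩ hlm hne
    have hne' : l ≠ m := fun h => hne (by simp [h])
    apply vz_eq_zero
    simp only at hlm ⊢
    rcases h with h | h | h | h | h | h <;>
    · rintro (h' | h' | h' | h' | h' | h' | h' | h') <;> omega
  by_cases h1 : m < q
  · exact key (2 * s + r + (q - 1 - m)) (by omega) (by omega) (by left; omega)
  by_cases h2 : m < q + r
  · exact key (2 * s + (r - 1 - (m - q))) (by omega) (by omega) (by right; left; omega)
  by_cases h3 : m < q + r + s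
  · exact key (s - 1 - (m - (q + r))) (by omega) (by omega) (by right; right; left; omega)
  by_cases h4 : m < q + r + s + t
  · exact key (2 * s + r + q + (m - (q + r + s))) (by omega) (by omega)
      (by right; right; right; left; omega)
  by_cases h5 : m < q + r + s + t + r
  · exact key (2 * s + (r - 1 - (m - (q + r + s + t)))) (by omega) (by omega)
      (by right; right; right; right; left; omega)
  · exact key (s - 1 - (m - (q + r + s + t + r))) (by omega) (by omega)
      (by right; right; right; right; right; omega)

lemma sTilde_inj {k : Type*} [Field k] {q r s t : ℕ}
    {g : Matrix (Fin (q + r + s + (t + r + s))) (Fin (q + r + s + (t + r + s))) k}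
    (hg : g ∈ sTilde k q r s t) (v : Fin (q + r + s + (t + r + s)) → k)
    (hv : g *ᵥ v = 0) : v = 0 := by
  have step : ∀ i p : Fin (q + r + s + (t + r + s)), g i p = 1 →
      (∀ l, l ≠ p → g i l = 0 ∨ v l = 0) → v p = 0 := by
    intro i p h1 h0
    have h := congrFun hv i
    simp only [Matrix.mulVec, dotProduct, Pi.zero_apply] at h
    rw [Finset.sum_eq_single p, h1, one_mul] at h
    · exact h
    · intro l _ hl
      rcases h0 l hl with h | h <;> simp [h]
    · simp
  -- first block column
  have c1 : ∀ p : Fin (q + r + s + (t + r + s)), (p : ℕ) < s → v p = 0 := by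
    rintro ⟨p, hp⟩ h
    simp only at h
    apply step ⟨q + r + (s - 1 - p), by omega⟩
    · rw [hg _ _ (by simp only; omega)]
      exact vz_eq_one (by right; right; left; simp only; omega)
    · rintro ⟨l, hl⟩ hne
      have hne' : l ≠ p := fun h => hne (by simp [h])
      left
      rw [hg _ _ (by simp only; omega)]
      apply vz_eq_zero
      simp only
      rintro (h' | h' | h' | h' | h' | h' | h' | h') <;> omega
  have c2 : ∀ p : Fin (q + r + s + (t + r + s)), (p : ℕ) < 2 * s → v p = 0 := by
    rintro ⟨p, hp⟩ h
    simp only at h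
    by_cases hps : p < s
    · exact c1 _ hps
    apply step ⟨q + r + s + t + r + (p - s), by omega⟩
    · rw [hg _ _ (by simp only; omega)]
      apply vz_eq_one
      iterate 7 right
      simp only; omega
    · rintro ⟨l, hl⟩ hne
      have hne' : l ≠ p := fun h => hne (by simp [h])
      by_cases hls : l < s
      · exact Or.inr (c1 _ hls)
      left
      rw [hg _ _ (by simp only; omega)]
      apply vz_eq_zero
      simp only
      rintro (h' | h' | h' | h' | h' | h' | h' | h') <;> omega
  have c34 : ∀ p : Fin (q + r + s + (t + r + s)), (p : ℕ) < 2 * s + r + q → v p = 0 := by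
    rintro ⟨p, hp⟩ h
    simp only at h
    by_cases hps : p < 2 * s
    · exact c2 _ hps
    by_cases hpr : p < 2 * s + r
    · apply step ⟨q + (r - 1 - (p - 2 * s)), by omega⟩
      · rw [hg _ _ (by simp only; omega)]
        exact vz_eq_one (by right; left; simp only; omega)
      · rintro ⟨l, hl⟩ hne
        have hne' : l ≠ p := fun h => hne (by simp [h])
        by_cases hls : l < 2 * s
        · exact Or.inr (c2 _ hls)
        left
        rw [hg _ _ (by simp only; omega)]
        apply vz_eq_zero
        simp only
        rintro (h' | h' | h' | h' | h' | h' | h' | h') <;> omega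
    · apply step ⟨q - 1 - (p - (2 * s + r)), by omega⟩
      · rw [hg _ _ (by simp only; omega)]
        exact vz_eq_one (by left; simp only; omega)
      · rintro ⟨l, hl⟩ hne
        have hne' : l ≠ p := fun h => hne (by simp [h])
        by_cases hls : l < 2 * s
        · exact Or.inr (c2 _ hls)
        left
        rw [hg _ _ (by simp only; omega)]
        apply vz_eq_zero
        simp only
        rintro (h' | h' | h' | h' | h' | h' | h' | h') <;> omega
  funext p
  obtain ⟨p, hp⟩ := p
  by_cases hps : p < 2 * s + r + q
  · exact c34 _ hps
  -- the last two block columns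
  apply step ⟨q + r + s + (p - (2 * s + r + q)), by omega⟩
  · rw [hg _ _ (by simp only; omega)]
    by_cases hpt : p < 2 * s + r + q + t
    · exact vz_eq_one (by right; right; right; left; simp only; omega)
    · exact vz_eq_one (by right; right; right; right; right; left; simp only; omega)
  · rintro ⟨l, hl⟩ hne
    have hne' : l ≠ p := fun h => hne (by simp [h])
    by_cases hls : l < 2 * s + r + q
    · exact Or.inr (c34 _ hls)
    left
    rw [hg _ _ (by simp only; omega)]
    apply vz_eq_zero
    simp only
    rintro (h' | h' | h' | h' | h' | h' | h' | h') <;> omega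

/-- Every matrix in `S̃` is invertible, and if `g, g' ∈ S̃` satisfy
`g' = κg` for some `κ ∈ K`, then `g = g'` and `κ = 1`; i.e. `g ↦ Kg` is injective on
`S̃`. -/
theorem stmt7 (k : Type*) [Field k] (q r s t : ℕ)
    (hq : 1 ≤ q) (hr : 1 ≤ r) (hs : 1 ≤ s) (ht : 1 ≤ t) :
    (∀ g ∈ sTilde k q r s t, IsUnit g) ∧
    (∀ g ∈ sTilde k q r s t, ∀ g' ∈ sTilde k q r s t, ∀ κ ∈ kDiag k q r s t,
      g' = κ * g → g = g' ∧ κ = 1) := by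
  refine ⟨fun g hg => ?_, fun g hg g' hg' κ hκ h => ?_⟩
  · rw [← Matrix.mulVec_injective_iff_isUnit]
    intro v w hvw
    have h0 : g *ᵥ (v - w) = 0 := by
      rw [Matrix.mulVec_sub]
      exact sub_eq_zero.mpr hvw
    exact sub_eq_zero.mp (sTilde_inj hg _ h0)
  · have hone : κ = 1 := by
      ext i m
      by_cases him : (i : ℕ) < q + r + s ↔ (m : ℕ) < q + r + s
      · obtain ⟨j, hj, h1, h0⟩ := exists_col k q r s t m
        have e := congrFun (congrFun h i) j
        rw [Matrix.mul_apply, Finset.sum_eq_single m] at e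
        · rw [hg _ _ (fun hh => hj hh.1), hg' _ _ (fun hh => hj hh.1), h1, mul_one] at e
          rw [← e]
          by_cases hi : i = m
          · subst hi
            rw [h1, Matrix.one_apply_eq]
          · rw [h0 i him hi, Matrix.one_apply_ne hi]
        · intro l _ hl
          by_cases hlm : (l : ℕ) < q + r + s ↔ (m : ℕ) < q + r + s
          · rw [hg _ _ (fun hh => hj hh.1), h0 l hlm hl, mul_zero]
          · rw [hκ.2 i l (by omega), zero_mul]
        · simp
      · have hne : i ≠ m := by
          rintro rfl
          exact him Iff.rfl
        rw [hκ.2 i m (by omega), Matrix.one_apply_ne hne]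
    refine ⟨?_, hone⟩
    rw [h, hone, one_mul]
end

section
/- Let U' ≤ B' be the unipotent radical of B' and T' ≤ B' the subgroup of diagonal matrices in B' (diagonal matrices whose first s+r diagonal entries are arbitrary nonzero scalars and whose remaining q+t+r+s diagonal entries equal 1). Let U₋ (resp. U₊) denote the lower (resp. upper) triangular matrices in GL(a+b,k) with all diagonal entries 1, and set U'_{−,w} = U' ∩ wU₋w⁻¹ and U'_{+,w} = U' ∩ wU₊w⁻¹. Then the multiplication map U'_{−,w} × U'_{+,w} × T' → B', (u₁, u₂, t) ↦ u₁u₂t, is a bijection. -/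
open Matrix

/-- The group `B'` (block rows and columns `(s, r, q, t, r, s)`): block lower triangular
with diagonal blocks (invertible lower triangular, invertible lower triangular, identity,
identity, unipotent lower triangular, unipotent lower triangular), the `(4,3)` block
zero, other below-diagonal blocks arbitrary. -/
def bPrime (k : Type*) [Field k] (q r s t : ℕ) :
    Set (Matrix (Fin (q + r + s + (t + r + s))) (Fin (q + r + s + (t + r + s))) k) :=
  {g | (∀ i j : Fin (q + r + s + (t + r + s)), (i : ℕ) < (j : ℕ) → g i j = 0) ∧
    (∀ i : Fin (q + r + s + (t + r + s)), (i : ℕ) < s + r → g i i ≠ 0) ∧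
    (∀ i j : Fin (q + r + s + (t + r + s)),
      inBlk (s + r) (q + t) (i : ℕ) → inBlk (s + r) (q + t) (j : ℕ) →
      g i j = if (i : ℕ) = (j : ℕ) then 1 else 0) ∧
    (∀ i : Fin (q + r + s + (t + r + s)), s + r + q + t ≤ (i : ℕ) → g i i = 1)}

/-- The maximal torus `T'` of `B'`: diagonal matrices whose first `s+r` diagonal entries
are arbitrary nonzero scalars and whose remaining diagonal entries are `1`. -/
def tPrime (k : Type*) [Field k] (q r s t : ℕ) :
    Set (Matrix (Fin (q + r + s + (t + r + s))) (Fin (q + r + s + (t + r + s))) k) :=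
  {g | (∀ i j : Fin (q + r + s + (t + r + s)), (i : ℕ) ≠ (j : ℕ) → g i j = 0) ∧
    (∀ i : Fin (q + r + s + (t + r + s)), (i : ℕ) < s + r → g i i ≠ 0) ∧
    (∀ i : Fin (q + r + s + (t + r + s)), s + r ≤ (i : ℕ) → g i i = 1)}

/-- The upper triangular unipotent group `U₊`. -/
def uPlus (k : Type*) [Field k] (q r s t : ℕ) :
    Set (Matrix (Fin (q + r + s + (t + r + s))) (Fin (q + r + s + (t + r + s))) k) :=
  {g | (∀ i j : Fin (q + r + s + (t + r + s)), (j : ℕ) < (i : ℕ) → g i j = 0) ∧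
    (∀ i : Fin (q + r + s + (t + r + s)), g i i = 1)}

/-- The permutation underlying `w`, on natural numbers. -/
def sigN (q r s t i : ℕ) : ℕ :=
  if i < s then 2 * s - 1 - i
  else if i < s + r then 2 * s + r + q + t + (r - 1 - (i - s))
  else if i < s + r + q then 2 * s + r + (q - 1 - (i - (s + r)))
  else if i < s + r + q + t then i + s
  else if i < s + r + q + t + r then 2 * s + (r - 1 - (i - (s + r + q + t)))
  else s - 1 - (i - (s + r + q + t + r))

lemma sigN_lt (q r s t i : ℕ) (h : i < q + r + s + (t + r + s)) :
    sigN q r s t i < q + r + s + (t + r + s) := by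
  unfold sigN; split_ifs <;> omega

lemma sigN_inj (q r s t i j : ℕ) (hi : i < q + r + s + (t + r + s))
    (hj : j < q + r + s + (t + r + s)) (h : sigN q r s t i = sigN q r s t j) : i = j := by
  unfold sigN at h; split_ifs at h <;> omega

lemma sigN_iff (q r s t i j : ℕ) (hi : i < q + r + s + (t + r + s)) :
    (Jpos 0 s s i j ∨ Jpos s (2 * s + r + q + t) r i j ∨
       Jpos (s + r) (2 * s + r) q i j ∨
       Ipos (s + r + q) (2 * s + r + q) t i j ∨
       Jpos (s + r + q + t) (2 * s) r i j ∨
       Jpos (s + r + q + t + r) 0 s i j) ↔ sigN q r s t i = j := by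
  unfold Jpos Ipos inBlk
  constructor
  · rintro (h | h | h | h | h | h) <;> unfold sigN <;> split_ifs <;> omega
  · unfold sigN
    intro h
    split_ifs at h
    · exact Or.inl (by omega)
    · exact Or.inr (Or.inl (by omega))
    · exact Or.inr (Or.inr (Or.inl (by omega)))
    · exact Or.inr (Or.inr (Or.inr (Or.inl (by omega))))
    · exact Or.inr (Or.inr (Or.inr (Or.inr (Or.inl (by omega)))))
    · exact Or.inr (Or.inr (Or.inr (Or.inr (Or.inr (by omega)))))

/-- The permutation underlying `w`. -/
noncomputable def sig (q r s t : ℕ) : Equiv.Perm (Fin (q + r + s + (t + r + s))) :=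
  Equiv.ofBijective (fun i => ⟨sigN q r s t i, sigN_lt q r s t i i.2⟩)
    (Finite.injective_iff_bijective.1 fun i j h =>
      Fin.ext (sigN_inj q r s t i j i.2 j.2 (Fin.mk.inj_iff.1 h)))

lemma wMat_eq (k : Type*) [Field k] (q r s t : ℕ) :
    wMat k q r s t = (1 : Matrix _ _ k).submatrix (sig q r s t) id := by
  ext i j
  simp only [wMat, Matrix.of_apply, Matrix.submatrix_apply, Matrix.one_apply, id]
  refine if_congr ?_ rfl rfl
  rw [sigN_iff q r s t i j i.2, Fin.ext_iff]
  rfl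

lemma w_conj (k : Type*) [Field k] (q r s t : ℕ)
    (u : Matrix (Fin (q + r + s + (t + r + s))) (Fin (q + r + s + (t + r + s))) k) :
    wMat k q r s t * u * (wMat k q r s t)⁻¹ = u.submatrix (sig q r s t) (sig q r s t) := by
  have hinv : (wMat k q r s t)⁻¹ = (1 : Matrix _ _ k).submatrix id (sig q r s t) := by
    apply Matrix.inv_eq_right_inv
    rw [wMat_eq]
    ext i j
    simp [Matrix.mul_apply, Matrix.one_apply]
  rw [hinv, wMat_eq]
  ext i j
  simp [Matrix.mul_apply, Matrix.one_apply]

/-- Pattern matrices: ones on the diagonal, zero off the diagonal outside of `P`. -/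
def Pat {n : ℕ} {k : Type*} [Field k] (P : Fin n → Fin n → Prop)
    (g : Matrix (Fin n) (Fin n) k) : Prop :=
  (∀ i, g i i = 1) ∧ ∀ i j, i ≠ j → ¬ P i j → g i j = 0

lemma mul_low {n : ℕ} {k : Type*} [Field k] (u v : Matrix (Fin n) (Fin n) k)
    (hu : Pat (fun i j => j < i) u) (hv : Pat (fun i j => j < i) v) (i j : Fin n)
    (hij : j < i) :
    (u * v) i j = u i j + v i j + ∑ m, if j < m ∧ m < i then u i m * v m j else 0 := by
  have : ∀ m, u i m * v m j = (if m = j then u i j else 0) + (if m = i then v i j else 0)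
      + (if j < m ∧ m < i then u i m * v m j else 0) := by
    intro m
    by_cases h1 : m = j
    · subst h1; simp [hv.1, hij.ne]
    by_cases h2 : m = i
    · subst h2; simp [hu.1, h1]
    by_cases h3 : j < m ∧ m < i
    · simp [h1, h2, h3]
    · rw [if_neg h1, if_neg h2, if_neg h3]
      by_cases h4 : j < m
      · rw [hu.2 i m (Ne.symm h2) (fun h => h3 ⟨h4, h⟩)]; simp
      · rw [hv.2 m j h1 h4]; simp
  rw [Matrix.mul_apply, Finset.sum_congr rfl fun m _ => this m]
  simp [Finset.sum_add_distrib]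

lemma mul_diag {n : ℕ} {k : Type*} [Field k] (u v : Matrix (Fin n) (Fin n) k)
    (hu : Pat (fun i j => j < i) u) (hv : Pat (fun i j => j < i) v) (i : Fin n) :
    (u * v) i i = 1 := by
  rw [Matrix.mul_apply, Finset.sum_eq_single i]
  · simp [hu.1, hv.1]
  · intro m _ hm
    by_cases h : m < i
    · rw [hv.2 m i hm (by omega)]; simp
    · rw [hu.2 i m (Ne.symm hm) h]; simp
  · simp

lemma Pat.mono {n : ℕ} {k : Type*} [Field k] {P Q : Fin n → Fin n → Prop}
    {g : Matrix (Fin n) (Fin n) k} (h : Pat P g) (hPQ : ∀ i j, P i j → Q i j) : Pat Q g :=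
  ⟨h.1, fun i j hij hq => h.2 i j hij fun hp => hq (hPQ i j hp)⟩

lemma Pat.mul {n : ℕ} {k : Type*} [Field k] {P : Fin n → Fin n → Prop}
    (hP : ∀ i j, P i j → j < i) (htr : ∀ i m j, P i m → P m j → P i j)
    {u v : Matrix (Fin n) (Fin n) k} (hu : Pat P u) (hv : Pat P v) : Pat P (u * v) := by
  refine ⟨mul_diag u v (hu.mono hP) (hv.mono hP), fun i j hij hp => ?_⟩
  rw [Matrix.mul_apply]
  refine Finset.sum_eq_zero fun m _ => ?_
  by_cases h1 : i = m
  · subst h1; rw [hv.2 i j hij hp, mul_zero]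
  by_cases h2 : m = j
  · subst h2; rw [hu.2 i m hij hp, zero_mul]
  by_cases h3 : P i m
  · rw [hv.2 m j h2 fun h => hp (htr _ _ _ h3 h), mul_zero]
  · rw [hu.2 i m h1 h3, zero_mul]

open Classical in
/-- Recursively computed coefficients of the factorization. -/
noncomputable def coef {n : ℕ} {k : Type*} [Field k] (S : Fin n → Fin n → Prop)
    (g : Matrix (Fin n) (Fin n) k) (i j : Fin n) : k :=
  g i j - ∑ m : Fin n, if _h : j < m ∧ m < i then
    (if S i m then coef S g i m else 0) * (if S m j then 0 else coef S g m j) else 0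
termination_by (i : ℕ) - (j : ℕ)
decreasing_by all_goals omega

lemma coef_zero {n : ℕ} {k : Type*} [Field k] (S P : Fin n → Fin n → Prop)
    (htr : ∀ i m j, P i m → P m j → P i j) (g : Matrix (Fin n) (Fin n) k) (hg : Pat P g) :
    ∀ (d : ℕ) (i j : Fin n), (i : ℕ) - j < d → j < i → ¬ P i j → coef S g i j = 0 := by
  intro d
  induction d with
  | zero => intro i j h; omega
  | succ d ih =>
    intro i j hd hij hp
    rw [coef, hg.2 i j hij.ne' hp, zero_sub, neg_eq_zero]
    refine Finset.sum_eq_zero fun m _ => ?_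
    split_ifs with h h1 h2 h2 <;> try simp only [zero_mul, mul_zero]
    obtain ⟨ha, hb⟩ := h
    by_cases h3 : P i m
    · rw [ih m j (by simp only [Fin.lt_def] at *; omega) ha fun h => hp (htr _ _ _ h3 h), mul_zero]
    · rw [ih i m (by simp only [Fin.lt_def] at *; omega) hb h3, zero_mul]

lemma exists_fac {n : ℕ} {k : Type*} [Field k] (S P : Fin n → Fin n → Prop)
    (hP : ∀ i j, P i j → j < i) (htr : ∀ i m j, P i m → P m j → P i j)
    (g : Matrix (Fin n) (Fin n) k) (hg : Pat P g) :
    ∃ u v, Pat (fun i j => P i j ∧ S i j) u ∧ Pat (fun i j => P i j ∧ ¬ S i j) v ∧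
      u * v = g := by
  classical
  have h0 : ∀ i j, j < i → ¬ P i j → coef S g i j = 0 := fun i j =>
    coef_zero S P htr g hg _ i j (Nat.lt_succ_self _)
  let u : Matrix (Fin n) (Fin n) k := fun i j =>
    if i = j then 1 else if P i j ∧ S i j then coef S g i j else 0
  let v : Matrix (Fin n) (Fin n) k := fun i j =>
    if i = j then 1 else if P i j ∧ ¬ S i j then coef S g i j else 0
  have hu : Pat (fun i j => P i j ∧ S i j) u :=
    ⟨fun i => by simp [u], fun i j hij h => by simp only [u]; rw [if_neg hij, if_neg h]⟩
  have hv : Pat (fun i j => P i j ∧ ¬ S i j) v :=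
    ⟨fun i => by simp [v], fun i j hij h => by simp only [v]; rw [if_neg hij, if_neg h]⟩
  have hu' := hu.mono (Q := P) fun i j h => h.1
  have hv' := hv.mono (Q := P) fun i j h => h.1
  refine ⟨u, v, hu, hv, ?_⟩
  ext i j
  have hm := Pat.mul hP htr hu' hv'
  by_cases hij : i = j
  · subst hij; rw [hm.1, hg.1]
  by_cases hp : P i j
  · have hlt := hP i j hp
    rw [mul_low u v (hu'.mono hP) (hv'.mono hP) i j hlt]
    have hs : u i j + v i j = coef S g i j := by
      simp only [u, v, if_neg hij]
      by_cases h : S i j <;> simp [h, hp]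
    rw [hs, coef]
    have : ∀ m, (if j < m ∧ m < i then u i m * v m j else 0) =
      if _h : j < m ∧ m < i then
        (if S i m then coef S g i m else 0) * (if S m j then 0 else coef S g m j) else 0 := by
      intro m
      by_cases h : j < m ∧ m < i
      · rw [if_pos h, dif_pos h]
        have e1 : u i m = if S i m then coef S g i m else 0 := by
          simp only [u, if_neg h.2.ne']
          by_cases hp : P i m
          · simp [hp]
          · simp [hp, h0 i m h.2 hp]
        have e2 : v m j = if S m j then 0 else coef S g m j := by
          simp only [v, if_neg h.1.ne']
          by_cases hp : P m j
          · simp [hp]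
          · simp [hp, h0 m j h.1 hp]
        rw [e1, e2]
      · rw [if_neg h, dif_neg h]
    rw [Finset.sum_congr rfl fun m _ => this m]
    ring
  · rw [hm.2 i j hij hp, hg.2 i j hij hp]

lemma unique_fac {n : ℕ} {k : Type*} [Field k] (S : Fin n → Fin n → Prop)
    (u v u' v' : Matrix (Fin n) (Fin n) k)
    (hu : Pat (fun i j => j < i ∧ S i j) u) (hv : Pat (fun i j => j < i ∧ ¬ S i j) v)
    (hu' : Pat (fun i j => j < i ∧ S i j) u') (hv' : Pat (fun i j => j < i ∧ ¬ S i j) v')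
    (h : u * v = u' * v') : u = u' ∧ v = v' := by
  have key : ∀ (d : ℕ) (i j : Fin n), (i : ℕ) - j < d → u i j = u' i j ∧ v i j = v' i j := by
    intro d
    induction d with
    | zero => intro i j h; omega
    | succ d ih =>
      intro i j hd
      by_cases hij : i = j
      · subst hij; simp [hu.1, hv.1, hu'.1, hv'.1]
      by_cases hlt : j < i
      · have e := congrFun (congrFun h i) j
        rw [mul_low u v (hu.mono fun _ _ h => h.1) (hv.mono fun _ _ h => h.1) i j hlt,
          mul_low u' v' (hu'.mono fun _ _ h => h.1) (hv'.mono fun _ _ h => h.1) i j hlt] at e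
        have : ∀ m, (if j < m ∧ m < i then u i m * v m j else 0) =
            if j < m ∧ m < i then u' i m * v' m j else 0 := by
          intro m
          split_ifs with hm
          · rw [(ih i m (by simp only [Fin.lt_def] at *; omega)).1,
              (ih m j (by simp only [Fin.lt_def] at *; omega)).2]
          · rfl
        rw [Finset.sum_congr rfl fun m _ => this m] at e
        have e := add_right_cancel e
        by_cases hS : S i j
        · have a := hv.2 i j hij fun h => h.2 hS
          have b := hv'.2 i j hij fun h => h.2 hS
          rw [a, b] at e ⊢
          simpa using e
        · have a := hu.2 i j hij fun h => hS h.2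
          have b := hu'.2 i j hij fun h => hS h.2
          rw [a, b] at e ⊢
          simpa using e
      · rw [hu.2 i j hij fun h => hlt h.1, hv.2 i j hij fun h => hlt h.1,
          hu'.2 i j hij fun h => hlt h.1, hv'.2 i j hij fun h => hlt h.1]
        simp
  constructor <;> ext i j
  · exact (key _ i j (Nat.lt_succ_self _)).1
  · exact (key _ i j (Nat.lt_succ_self _)).2

/-- The root pattern of `U'`. -/
def PP (q r s t : ℕ) (i j : Fin (q + r + s + (t + r + s))) : Prop :=
  j < i ∧ ¬ (inBlk (s + r) (q + t) (i : ℕ) ∧ inBlk (s + r) (q + t) (j : ℕ))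

lemma uPrime_iff (k : Type*) [Field k] (q r s t : ℕ)
    (g : Matrix (Fin (q + r + s + (t + r + s))) (Fin (q + r + s + (t + r + s))) k) :
    g ∈ uPrime k q r s t ↔ Pat (PP q r s t) g := by
  constructor
  · rintro ⟨h1, h2, h3⟩
    refine ⟨h2, fun i j hij hp => ?_⟩
    have hne : (i : ℕ) ≠ j := fun h => hij (Fin.ext h)
    by_cases hlt : j < i
    · have : inBlk (s + r) (q + t) (i : ℕ) ∧ inBlk (s + r) (q + t) (j : ℕ) := by
        by_contra h
        exact hp ⟨hlt, h⟩
      exact h3 i j this.1 this.2 hne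
    · exact h1 i j (by simp only [Fin.lt_def] at hlt; omega)
  · rintro ⟨h1, h2⟩
    refine ⟨fun i j h => h2 i j (by rintro rfl; omega) fun hp => ?_, h1,
      fun i j hi hj hne => h2 i j (by rintro rfl; omega) fun hp => hp.2 ⟨hi, hj⟩⟩
    have := hp.1
    simp only [Fin.lt_def] at this
    omega

lemma uMinus_iff (k : Type*) [Field k] (q r s t : ℕ)
    (g : Matrix (Fin (q + r + s + (t + r + s))) (Fin (q + r + s + (t + r + s))) k) :
    g ∈ uPrime k q r s t ∩
      ((fun u => wMat k q r s t * u * (wMat k q r s t)⁻¹) '' uMinus k q r s t) ↔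
    Pat (fun i j => PP q r s t i j ∧ sig q r s t j < sig q r s t i) g := by
  rw [Set.mem_inter_iff, uPrime_iff]
  constructor
  · rintro ⟨h1, u, ⟨hu, _⟩, rfl⟩
    refine ⟨h1.1, fun i j hij hp => ?_⟩
    by_cases h : PP q r s t i j
    · simp only [w_conj, Matrix.submatrix_apply]
      apply hu
      have h4 : ¬ sig q r s t j < sig q r s t i := fun h' => hp ⟨h, h'⟩
      have h5 : sig q r s t i ≠ sig q r s t j := fun h' => hij ((sig q r s t).injective h')
      exact Fin.lt_def.1 (lt_of_le_of_ne (not_lt.1 h4) h5)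
    · exact h1.2 i j hij h
  · intro h
    refine ⟨h.mono fun _ _ h => h.1,
      g.submatrix (sig q r s t).symm (sig q r s t).symm, ⟨fun i j hij => ?_, fun i => ?_⟩, ?_⟩
    · simp only [Matrix.submatrix_apply]
      refine h.2 _ _ (fun h' => ?_) (fun h' => ?_)
      · have := (sig q r s t).symm.injective h'
        subst this; omega
      · have := h'.2
        simp only [Equiv.apply_symm_apply, Fin.lt_def] at this
        omega
    · exact h.1 _
    · simp only [w_conj]
      ext i j
      simp

lemma uPlus_iff (k : Type*) [Field k] (q r s t : ℕ)
    (g : Matrix (Fin (q + r + s + (t + r + s))) (Fin (q + r + s + (t + r + s))) k) :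
    g ∈ uPrime k q r s t ∩
      ((fun u => wMat k q r s t * u * (wMat k q r s t)⁻¹) '' uPlus k q r s t) ↔
    Pat (fun i j => PP q r s t i j ∧ ¬ sig q r s t j < sig q r s t i) g := by
  rw [Set.mem_inter_iff, uPrime_iff]
  constructor
  · rintro ⟨h1, u, ⟨hu, _⟩, rfl⟩
    refine ⟨h1.1, fun i j hij hp => ?_⟩
    by_cases h : PP q r s t i j
    · simp only [w_conj, Matrix.submatrix_apply]
      apply hu
      by_contra h'
      exact hp ⟨h, h'⟩
    · exact h1.2 i j hij h
  · intro h
    refine ⟨h.mono fun _ _ h => h.1,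
      g.submatrix (sig q r s t).symm (sig q r s t).symm, ⟨fun i j hij => ?_, fun i => ?_⟩, ?_⟩
    · simp only [Matrix.submatrix_apply]
      refine h.2 _ _ (fun h' => ?_) (fun h' => ?_)
      · have := (sig q r s t).symm.injective h'
        subst this; omega
      · have := h'.2
        simp only [Equiv.apply_symm_apply, Fin.lt_def] at this
        omega
    · exact h.1 _
    · simp only [w_conj]
      ext i j
      simp

lemma PP_trans (q r s t : ℕ) (i m j : Fin (q + r + s + (t + r + s)))
    (h1 : PP q r s t i m) (h2 : PP q r s t m j) : PP q r s t i j := by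
  simp only [PP, inBlk, Fin.lt_def] at *
  omega

lemma tPrime_mul (k : Type*) [Field k] (q r s t : ℕ)
    (g d : Matrix (Fin (q + r + s + (t + r + s))) (Fin (q + r + s + (t + r + s))) k)
    (hd : d ∈ tPrime k q r s t) (i j) : (g * d) i j = g i j * d j j := by
  rw [Matrix.mul_apply, Finset.sum_eq_single j]
  · intro m _ hm
    rw [hd.1 m j fun h => hm (Fin.ext h), mul_zero]
  · simp

lemma tPrime_ne (k : Type*) [Field k] (q r s t : ℕ)
    (d : Matrix (Fin (q + r + s + (t + r + s))) (Fin (q + r + s + (t + r + s))) k)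
    (hd : d ∈ tPrime k q r s t) (j) : d j j ≠ 0 := by
  by_cases h : (j : ℕ) < s + r
  · exact hd.2.1 j h
  · rw [hd.2.2 j (by omega)]; exact one_ne_zero

/-- With `U'_{−,w} = U' ∩ wU₋w⁻¹` and `U'_{+,w} = U' ∩ wU₊w⁻¹`, the
multiplication map `U'_{−,w} × U'_{+,w} × T' → B'`, `(u₁, u₂, t) ↦ u₁u₂t`, is a
bijection. -/
theorem stmt10 (k : Type*) [Field k] (q r s t : ℕ)
    (hq : 1 ≤ q) (hr : 1 ≤ r) (hs : 1 ≤ s) (ht : 1 ≤ t) :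
    Set.BijOn
      (fun x : Matrix (Fin (q + r + s + (t + r + s))) (Fin (q + r + s + (t + r + s))) k ×
          Matrix (Fin (q + r + s + (t + r + s))) (Fin (q + r + s + (t + r + s))) k ×
          Matrix (Fin (q + r + s + (t + r + s))) (Fin (q + r + s + (t + r + s))) k =>
        x.1 * x.2.1 * x.2.2)
      ((uPrime k q r s t ∩
          ((fun u => wMat k q r s t * u * (wMat k q r s t)⁻¹) '' uMinus k q r s t)) ×ˢ
        ((uPrime k q r s t ∩
          ((fun u => wMat k q r s t * u * (wMat k q r s t)⁻¹) '' uPlus k q r s t)) ×ˢ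
          tPrime k q r s t))
      (bPrime k q r s t) := by
  have hPlt : ∀ i j, PP q r s t i j → j < i := fun i j h => h.1
  have htr := PP_trans q r s t
  refine ⟨?_, ?_, ?_⟩
  · rintro ⟨u, v, d⟩ ⟨hu, hv, hd⟩
    simp only at hu hv hd
    rw [uMinus_iff] at hu
    rw [uPlus_iff] at hv
    have hm := Pat.mul hPlt htr (hu.mono fun _ _ h => h.1) (hv.mono fun _ _ h => h.1)
    have hm' := (uPrime_iff k q r s t _).2 hm
    refine ⟨fun i j h => ?_, fun i h => ?_, fun i j hi hj => ?_, fun i h => ?_⟩ <;>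
      simp only [tPrime_mul k q r s t _ d hd]
    · rw [hm'.1 i j h, zero_mul]
    · rw [hm.1, one_mul]; exact hd.2.1 i h
    · split_ifs with h
      · have := Fin.ext h
        subst this
        rw [hm.1, one_mul, hd.2.2 i hi.1]
      · rw [hm'.2.2 i j hi hj h, zero_mul]
    · rw [hm.1, one_mul, hd.2.2 i (by omega)]
  · rintro ⟨u, v, d⟩ ⟨hu, hv, hd⟩ ⟨u', v', d'⟩ ⟨hu', hv', hd'⟩ h
    simp only at hu hv hd hu' hv' hd' h
    rw [uMinus_iff] at hu hu'
    rw [uPlus_iff] at hv hv'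
    have hm := Pat.mul hPlt htr (hu.mono fun _ _ h => h.1) (hv.mono fun _ _ h => h.1)
    have hm' := Pat.mul hPlt htr (hu'.mono fun _ _ h => h.1) (hv'.mono fun _ _ h => h.1)
    have e : ∀ i j, (u * v) i j * d j j = (u' * v') i j * d' j j := fun i j => by
      rw [← tPrime_mul k q r s t _ d hd, ← tPrime_mul k q r s t _ d' hd', h]
    have ed : ∀ j, d j j = d' j j := fun j => by
      have := e j j
      rwa [hm.1, hm'.1, one_mul, one_mul] at this
    have hdd : d = d' := by
      ext i j
      by_cases hij : i = j
      · subst hij; exact ed i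
      · have hne : (i : ℕ) ≠ j := fun h => hij (Fin.ext h)
        rw [hd.1 i j hne, hd'.1 i j hne]
    have huv : u * v = u' * v' := by
      ext i j
      have := e i j
      rw [ed j] at this
      exact mul_right_cancel₀ (tPrime_ne k q r s t d' hd' j) this
    obtain ⟨h1, h2⟩ := unique_fac (fun i j => sig q r s t j < sig q r s t i) u v u' v'
      (hu.mono fun _ _ h => ⟨h.1.1, h.2⟩) (hv.mono fun _ _ h => ⟨h.1.1, h.2⟩)
      (hu'.mono fun _ _ h => ⟨h.1.1, h.2⟩) (hv'.mono fun _ _ h => ⟨h.1.1, h.2⟩) huv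
    rw [h1, h2, hdd]
  · rintro g ⟨h1, h2, h3, h4⟩
    have hdiag : ∀ i : Fin (q + r + s + (t + r + s)), s + r ≤ (i : ℕ) → g i i = 1 := by
      intro i hi
      by_cases h : s + r + q + t ≤ (i : ℕ)
      · exact h4 i h
      · have hb : inBlk (s + r) (q + t) (i : ℕ) := ⟨hi, by omega⟩
        simpa using h3 i i hb hb
    have hd : Matrix.diagonal (fun i => g i i) ∈ tPrime k q r s t := by
      refine ⟨fun i j h => Matrix.diagonal_apply_ne _ fun h' => h (by rw [h']),
        fun i h => ?_, fun i h => ?_⟩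
      · rw [Matrix.diagonal_apply_eq]; exact h2 i h
      · rw [Matrix.diagonal_apply_eq]; exact hdiag i h
    have hne : ∀ j, g j j ≠ 0 := fun j => by
      have := tPrime_ne k q r s t _ hd j
      rwa [Matrix.diagonal_apply_eq] at this
    have hg : Pat (PP q r s t) (Matrix.of fun i j => g i j * (g j j)⁻¹) := by
      rw [← uPrime_iff]
      refine ⟨fun i j h => ?_, fun i => ?_, fun i j hi hj h => ?_⟩ <;>
        simp only [Matrix.of_apply]
      · rw [h1 i j h, zero_mul]
      · exact mul_inv_cancel₀ (hne i)
      · rw [h3 i j hi hj, if_neg h, zero_mul]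
    obtain ⟨u, v, hu, hv, huv⟩ := exists_fac
      (fun i j => sig q r s t j < sig q r s t i) (PP q r s t) hPlt htr _ hg
    refine ⟨(u, v, Matrix.diagonal (fun i => g i i)),
      ⟨(uMinus_iff k q r s t u).2 hu, (uPlus_iff k q r s t v).2 hv, hd⟩, ?_⟩
    simp only [huv]
    ext i j
    rw [tPrime_mul k q r s t _ _ hd, Matrix.diagonal_apply_eq, Matrix.of_apply,
      inv_mul_cancel_right₀ (hne j)]
end

section
/- Let k be a field and R = k[a₁, a₂, b₁, b₂, c₁, c₂] a polynomial ring in six variables. Then the ideal ((a₁b₂ − a₂b₁) ∩ (a₁c₂ − a₂c₁)) + (b₁c₂ − b₂c₁) — i.e., the sum of the intersection of the principal ideals generated by a₁b₂ − a₂b₁ and by a₁c₂ − a₂c₁ with the principal ideal generated by b₁c₂ − b₂c₁ — is not a radical ideal of R. -/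
open MvPolynomial

/-- In `R = k[a₁,a₂,b₁,b₂,c₁,c₂]` (variables `X 0,…,X 5` in the order
`a₁,a₂,b₁,b₂,c₁,c₂`), the ideal
`((a₁b₂ − a₂b₁) ∩ (a₁c₂ − a₂c₁)) + (b₁c₂ − b₂c₁)` is not radical. -/
theorem stmt15 (k : Type*) [Field k] :
    ¬ ((Ideal.span {(X 0 * X 3 - X 1 * X 2 : MvPolynomial (Fin 6) k)} ⊓
        Ideal.span {(X 0 * X 5 - X 1 * X 4 : MvPolynomial (Fin 6) k)}) ⊔
        Ideal.span {(X 2 * X 5 - X 3 * X 4 : MvPolynomial (Fin 6) k)}).IsRadical := by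
  intro hrad
  have hmem := @hrad ((X 0 * X 3 - X 1 * X 2) * X 4) ⟨2, by
    refine Submodule.mem_sup.2 ⟨(X 0 * X 3 - X 1 * X 2) * (X 0 * X 5 - X 1 * X 4) * (X 4 * X 2),
      ⟨?_, ?_⟩, (X 2 * X 5 - X 3 * X 4) * (-(X 0 * X 3 - X 1 * X 2) * X 4 * X 0), ?_, by ring⟩
    · exact Ideal.mem_span_singleton.2 ⟨(X 0 * X 5 - X 1 * X 4) * (X 4 * X 2), by ring⟩
    · exact Ideal.mem_span_singleton.2 ⟨(X 0 * X 3 - X 1 * X 2) * (X 4 * X 2), by ring⟩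
    · exact Ideal.mem_span_singleton.2 ⟨_, rfl⟩⟩
  obtain ⟨y, ⟨hy1, hy2⟩, z, hz, hyz⟩ := Submodule.mem_sup.1 hmem
  obtain ⟨p, rfl⟩ := Ideal.mem_span_singleton.1 hy1
  obtain ⟨q, hq⟩ := Ideal.mem_span_singleton.1 hy2
  obtain ⟨r, rfl⟩ := Ideal.mem_span_singleton.1 hz
  let φ : MvPolynomial (Fin 6) k →ₐ[k] MvPolynomial (Fin 6) k :=
    aeval ![0, 0, X 2, X 3, X 4, X 5]
  have e0 : φ (X 0) = 0 := by simp [φ]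
  have e1 : φ (X 1) = 0 := by simp [φ]
  have e2 : φ (X 2) = X 2 := by simp [φ]
  have e3 : φ (X 3) = X 3 := by simp [φ]
  have e4 : φ (X 4) = X 4 := by simp [φ]
  have e5 : φ (X 5) = X 5 := by simp [φ]
  have h0 := congrArg (fun t => φ (pderiv 0 t)) hq
  have h1 := congrArg (fun t => φ (pderiv 1 t)) hq
  have h2 := congrArg (fun t => φ (pderiv 1 t)) hyz
  simp [pderiv_X, Pi.single_apply, Derivation.leibniz, e0, e1, e2, e3, e4, e5] at h0 h1 h2
  have hp : (X 2 * X 5 - X 3 * X 4 : MvPolynomial (Fin 6) k) * φ p = 0 := by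
    grind
  let v : Fin 6 → k := ![0, 0, 1, 0, 1, 0]
  have hne : (X 2 * X 5 - X 3 * X 4 : MvPolynomial (Fin 6) k) ≠ 0 := by
    intro h
    have := congrArg (eval (![0, 0, 1, 0, 0, 1] : Fin 6 → k)) h
    simp at this
  have hp0 : φ p = 0 := (mul_eq_zero.1 hp).resolve_left hne
  rw [hp0] at h2
  have := congrArg (eval v) h2
  simp [v] at this
end
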